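/- For every positive integer i, every real β ≥ 1/2, and every real α ≥ i, the function x ↦ α |ψ^{(i)}(x+β)| - x |ψ^{(i+1)}(x+β)| is completely monotonic on (0, ∞). -/

import Mathlib

open Real Set MeasureTheory Filter

/-- The k-th polygamma function: the (k+1)-st derivative of log Γ. -/
noncomputable def polygamma (k : ℕ) : ℝ → ℝ :=
  iteratedDeriv (k + 1) (fun x => Real.log (Real.Gamma x))

/-- A function is completely monotonic on (0,∞). -/
def CompletelyMonotonicOn (f : ℝ → ℝ) : Prop :=
  (∀ k : ℕ, ∀ x : ℝ, 0 < x → 0 ≤ (-1 : ℝ) ^ k * iteratedDeriv k f x)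

/-- The Hurwitz-type series `∑ 1/(y+n)^p`. -/
noncomputable def hurS (p : ℕ) (y : ℝ) : ℝ := ∑' n : ℕ, ((y + n) ^ p)⁻¹

lemma hurS_summable {p : ℕ} (hp : 2 ≤ p) {y : ℝ} (hy : 0 < y) :
    Summable (fun n : ℕ => ((y + n) ^ p)⁻¹) := by
  have h := (Real.summable_one_div_nat_add_rpow y p).2 (by exact_mod_cast hp)
  refine h.congr fun n => ?_
  have : (0 : ℝ) < n + y := by positivity
  rw [abs_of_pos this, Real.rpow_natCast, one_div, add_comm]

lemma hurS_nonneg (p : ℕ) {y : ℝ} (hy : 0 < y) : 0 ≤ hurS p y :=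
  tsum_nonneg fun n => by positivity

lemma hasDerivAt_inv_pow (p n : ℕ) {y : ℝ} (hy : 0 < y) :
    HasDerivAt (fun z : ℝ => ((z + n) ^ p)⁻¹) (-(p : ℝ) * ((y + n) ^ (p + 1))⁻¹) y := by
  have hpos : (0 : ℝ) < y + n := by positivity
  have h1 : HasDerivAt (fun z : ℝ => z + n) 1 y := (hasDerivAt_id y).add_const _
  have h2 := (h1.fun_pow p).fun_inv (pow_ne_zero p hpos.ne')
  refine h2.congr_deriv ?_
  rcases p with _ | p
  · simp
  · simp only [Nat.add_sub_cancel]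
    field_simp
    ring

lemma hurS_hasDerivAt {p : ℕ} (hp : 2 ≤ p) {y : ℝ} (hy : 0 < y) :
    HasDerivAt (hurS p) (-(p : ℝ) * hurS (p + 1) y) y := by
  have hy2 : 0 < y / 2 := by positivity
  have h := hasDerivAt_tsum_of_isPreconnected (t := Ioi (y / 2)) (y₀ := y) (y := y)
    (g := fun (n : ℕ) (z : ℝ) => ((z + n) ^ p)⁻¹)
    (g' := fun (n : ℕ) (z : ℝ) => -(p : ℝ) * ((z + n) ^ (p + 1))⁻¹)
    (u := fun n : ℕ => (p : ℝ) * ((y / 2 + n) ^ (p + 1))⁻¹)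
    ((hurS_summable (by omega) hy2).mul_left _) isOpen_Ioi isPreconnected_Ioi
    (fun n z hz => hasDerivAt_inv_pow p n (hy2.trans hz))
    (fun n z hz => by
      have hz' : y / 2 < z := hz
      have hz0 : 0 < z := hy2.trans hz'
      rw [neg_mul, norm_neg, Real.norm_of_nonneg (by positivity)]
      gcongr)
    (by simp [hy]) (hurS_summable hp hy) (by simp [hy])
  rw [tsum_mul_left] at h
  exact h


noncomputable def gterm (n : ℕ) (x : ℝ) : ℝ :=
  x * (Real.log (n + 2) - Real.log (n + 1)) + Real.log (n + 1) - Real.log (x + (n + 1))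

noncomputable def dgterm (n : ℕ) (x : ℝ) : ℝ :=
  (Real.log (n + 2) - Real.log (n + 1)) - (x + (n + 1))⁻¹

lemma gterm_hasDerivAt (n : ℕ) {x : ℝ} (hx : 0 < x) : HasDerivAt (gterm n) (dgterm n x) x := by
  have hpos : (0 : ℝ) < x + (n + 1) := by positivity
  have h1 : HasDerivAt (fun z : ℝ => z + ((n : ℝ) + 1)) 1 x := (hasDerivAt_id x).add_const _
  have h2 := h1.log hpos.ne'
  have h3 := (((hasDerivAt_id x).mul_const (Real.log (n + 2) - Real.log (n + 1))).add_const
    (Real.log (n + 1))).sub h2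
  refine h3.congr_deriv ?_
  simp [dgterm]

lemma dgterm_hasDerivAt (n : ℕ) {x : ℝ} (hx : 0 < x) :
    HasDerivAt (dgterm n) (((x + (n + 1)) ^ 2)⁻¹) x := by
  have hpos : (0 : ℝ) < x + (n + 1) := by positivity
  have h1 : HasDerivAt (fun z : ℝ => z + ((n : ℝ) + 1)) 1 x := (hasDerivAt_id x).add_const _
  have h2 := (h1.fun_inv hpos.ne').const_sub (Real.log (n + 2) - Real.log (n + 1))
  refine h2.congr_deriv ?_
  field_simp

lemma dgterm_bound (n : ℕ) {x M : ℝ} (hx : 0 < x) (hM : 1 ≤ M) (hxM : x ≤ M) :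
    ‖dgterm n x‖ ≤ M * ((1 + (n : ℝ)) ^ 2)⁻¹ := by
  have hn : (0 : ℝ) ≤ n := by positivity
  have hl : Real.log (n + 2) - Real.log (n + 1) = Real.log ((n + 2) / (n + 1)) :=
    (Real.log_div (by positivity) (by positivity)).symm
  have hq : (0 : ℝ) < ((n : ℝ) + 2) / (n + 1) := by positivity
  have hu : Real.log (((n : ℝ) + 2) / (n + 1)) ≤ (1 + (n : ℝ))⁻¹ := by
    refine (Real.log_le_sub_one_of_pos hq).trans (le_of_eq ?_)
    field_simp; ring
  have hlo : (n + 1 + M)⁻¹ ≤ Real.log (((n : ℝ) + 2) / (n + 1)) := by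
    refine le_trans ?_ (Real.one_sub_inv_le_log_of_pos hq)
    have : 1 - (((n : ℝ) + 2) / (n + 1))⁻¹ = ((n : ℝ) + 2)⁻¹ := by field_simp; ring
    rw [this]
    apply inv_anti₀ <;> linarith
  have h1 : (x + ((n : ℝ) + 1))⁻¹ ≤ (1 + (n : ℝ))⁻¹ := by
    apply inv_anti₀ <;> linarith
  have h2 : (n + 1 + M)⁻¹ ≤ (x + ((n : ℝ) + 1))⁻¹ := by
    apply inv_anti₀ <;> linarith
  have h3 : (1 + (n : ℝ))⁻¹ - (n + 1 + M)⁻¹ ≤ M * ((1 + (n : ℝ)) ^ 2)⁻¹ := by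
    have : (1 + (n : ℝ))⁻¹ - (n + 1 + M)⁻¹ = M * ((1 + (n : ℝ)) * (n + 1 + M))⁻¹ := by
      field_simp; ring
    rw [this]
    gcongr
    nlinarith
  rw [dgterm, hl, Real.norm_eq_abs, abs_le]
  constructor <;> linarith

lemma gterm_one (n : ℕ) : gterm n 1 = 0 := by
  unfold gterm
  have : (1 : ℝ) + (n + 1) = n + 2 := by ring
  rw [this]; ring

lemma gsum_bound (M : ℝ) : Summable (fun n : ℕ => M * ((1 + (n : ℝ)) ^ 2)⁻¹) :=
  (hurS_summable le_rfl one_pos).mul_left M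

lemma gterm_summable {x : ℝ} (hx : 0 < x) : Summable (fun n => gterm n x) :=
  summable_of_summable_hasDerivAt_of_isPreconnected (t := Ioo 0 (x + 2)) (y₀ := 1)
    (gsum_bound (x + 2)) isOpen_Ioo isPreconnected_Ioo
    (fun n z hz => gterm_hasDerivAt n hz.1)
    (fun n z hz => dgterm_bound n hz.1 (by linarith) hz.2.le)
    ⟨one_pos, by linarith⟩ (by simp only [gterm_one]; exact summable_zero) ⟨hx, by linarith⟩

lemma gterm_tsum_hasDerivAt {x : ℝ} (hx : 0 < x) :
    HasDerivAt (fun z => ∑' n, gterm n z) (∑' n, dgterm n x) x :=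
  hasDerivAt_tsum_of_isPreconnected (t := Ioo 0 (x + 2)) (y₀ := 1)
    (gsum_bound (x + 2)) isOpen_Ioo isPreconnected_Ioo
    (fun n z hz => gterm_hasDerivAt n hz.1)
    (fun n z hz => dgterm_bound n hz.1 (by linarith) hz.2.le)
    ⟨one_pos, by linarith⟩ (by simp only [gterm_one]; exact summable_zero) ⟨hx, by linarith⟩

lemma dgterm_tsum_hasDerivAt {x : ℝ} (hx : 0 < x) :
    HasDerivAt (fun z => ∑' n, dgterm n z) (∑' n : ℕ, ((x + ((n : ℝ) + 1)) ^ 2)⁻¹) x := by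
  refine hasDerivAt_tsum_of_isPreconnected (t := Ioi 0) (y₀ := x)
    (u := fun n : ℕ => 1 * ((1 + (n : ℝ)) ^ 2)⁻¹)
    (gsum_bound 1) isOpen_Ioi isPreconnected_Ioi
    (fun n z hz => dgterm_hasDerivAt n hz)
    (fun n z hz => ?_) hx ?_ hx
  · have hz' : 0 < z := hz
    rw [Real.norm_of_nonneg (by positivity), one_mul]
    gcongr ?_⁻¹
    gcongr ?_ ^ 2
    linarith
  · exact Summable.of_norm_bounded (gsum_bound (x + 1))
      (fun n => dgterm_bound n hx (by linarith) (by linarith))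

lemma gterm_partial (x : ℝ) (N : ℕ) :
    ∑ n ∈ Finset.range N, gterm n x - Real.log x =
      Real.BohrMollerup.logGammaSeq x N + x * (Real.log (N + 1) - Real.log N) := by
  have h : ∑ n ∈ Finset.range N, gterm n x = x * Real.log (N + 1) + Real.log (N.factorial)
      - ∑ m ∈ Finset.range N, Real.log (x + (m + 1)) := by
    induction N with
    | zero => simp
    | succ N ih =>
      rw [Finset.sum_range_succ, ih, Finset.sum_range_succ, Nat.factorial_succ, Nat.cast_mul,
        Real.log_mul (by positivity) (by positivity), gterm]
      push_cast
      have : (N : ℝ) + 1 + 1 = N + 2 := by ring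
      rw [this]; ring
  rw [h, Real.BohrMollerup.logGammaSeq, Finset.sum_range_succ']
  push_cast
  simp only [add_zero]
  ring

lemma log_Gamma_series {x : ℝ} (hx : 0 < x) :
    Real.log (Real.Gamma x) = ∑' n, gterm n x - Real.log x := by
  have h1 := ((gterm_summable hx).hasSum.tendsto_sum_nat).sub_const (Real.log x)
  have h2 := (Real.BohrMollerup.tendsto_log_gamma hx).add
    (Real.tendsto_log_nat_add_one_sub_log.const_mul x)
  simp only [gterm_partial] at h1
  have := tendsto_nhds_unique h1 h2
  simp at this
  exact this.symm

lemma polygamma_one {x : ℝ} (hx : 0 < x) : polygamma 1 x = hurS 2 x := by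
  have hA : ∀ y : ℝ, 0 < y → deriv (fun x => Real.log (Real.Gamma x)) y
      = ∑' n, dgterm n y - y⁻¹ := by
    intro y hy
    have h1 : (fun x => Real.log (Real.Gamma x)) =ᶠ[nhds y]
        (fun x => ∑' n, gterm n x - Real.log x) := by
      filter_upwards [Ioi_mem_nhds hy] with z hz using log_Gamma_series hz
    rw [h1.deriv_eq]
    exact ((gterm_tsum_hasDerivAt hy).sub (Real.hasDerivAt_log hy.ne')).deriv
  have h2 : deriv (fun x => Real.log (Real.Gamma x)) =ᶠ[nhds x]
      (fun y => ∑' n, dgterm n y - y⁻¹) := by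
    filter_upwards [Ioi_mem_nhds hx] with z hz using hA z hz
  rw [polygamma, iteratedDeriv_succ, iteratedDeriv_one, h2.deriv_eq]
  have h3 := ((dgterm_tsum_hasDerivAt hx).sub (hasDerivAt_inv hx.ne')).deriv
  refine Eq.trans h3 ?_
  rw [hurS, (hurS_summable le_rfl hx).tsum_eq_zero_add]
  push_cast
  simp only [add_zero]
  ring

lemma polygamma_series (k : ℕ) : ∀ x : ℝ, 0 < x →
    polygamma (k + 1) x = (-1) ^ k * (k + 1).factorial * hurS (k + 2) x := by
  induction k with
  | zero => intro x hx; simp [polygamma_one hx]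
  | succ k ih =>
    intro x hx
    have h1 : polygamma (k + 1) =ᶠ[nhds x]
        (fun x => (-1) ^ k * (k + 1).factorial * hurS (k + 2) x) := by
      filter_upwards [Ioi_mem_nhds hx] with z hz using ih z hz
    rw [polygamma, iteratedDeriv_succ]
    change deriv (polygamma (k + 1)) x = _
    rw [h1.deriv_eq, ((hurS_hasDerivAt (by omega) hx).const_mul _).deriv,
      Nat.factorial_succ (k + 1)]
    push_cast
    ring

/-- `|ψ^{(m)}|` -/
noncomputable def absP (m : ℕ) (y : ℝ) : ℝ := m.factorial * hurS (m + 1) y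

lemma abs_polygamma {m : ℕ} (hm : 1 ≤ m) {y : ℝ} (hy : 0 < y) :
    |polygamma m y| = absP m y := by
  obtain ⟨k, rfl⟩ : ∃ k, m = k + 1 := ⟨m - 1, by omega⟩
  rw [polygamma_series k y hy, absP, abs_mul, abs_mul, abs_pow, abs_neg, abs_one, one_pow, one_mul,
    abs_of_nonneg (hurS_nonneg _ hy), Nat.abs_cast]

lemma absP_hasDerivAt {m : ℕ} (hm : 1 ≤ m) {y : ℝ} (hy : 0 < y) :
    HasDerivAt (absP m) (-absP (m + 1) y) y := by
  have h := (hurS_hasDerivAt (p := m + 1) (by omega) hy).const_mul (m.factorial : ℝ)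
  refine h.congr_deriv ?_
  rw [absP, Nat.factorial_succ]
  push_cast
  ring

lemma two_term {u v : ℝ} (hu : 0 ≤ u) (hv : 0 ≤ v) (s t : ℕ) :
    u ^ s * v ^ t + u ^ t * v ^ s ≤ u ^ (s + t) + v ^ (s + t) := by
  have key : 0 ≤ (u ^ s - v ^ s) * (u ^ t - v ^ t) := by
    rcases le_total u v with h | h
    · exact mul_nonneg_of_nonpos_of_nonpos (sub_nonpos.2 (pow_le_pow_left₀ hu h s))
        (sub_nonpos.2 (pow_le_pow_left₀ hu h t))
    · exact mul_nonneg (sub_nonneg.2 (pow_le_pow_left₀ hv h s))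
        (sub_nonneg.2 (pow_le_pow_left₀ hv h t))
  rw [pow_add, pow_add]
  nlinarith

/-- Trapezoid rule -/
lemma trapezoid (p : ℕ) {a : ℝ} (ha : 0 < a) :
    (a ^ p)⁻¹ - ((a + 1) ^ p)⁻¹ ≤ p / 2 * ((a ^ (p + 1))⁻¹ + ((a + 1) ^ (p + 1))⁻¹) := by
  simp only [← inv_pow]
  have huv : a⁻¹ - (a + 1)⁻¹ = a⁻¹ * (a + 1)⁻¹ := by field_simp; ring
  have hu : 0 ≤ a⁻¹ := by positivity
  have hv : 0 ≤ (a + 1)⁻¹ := by positivity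
  generalize a⁻¹ = u at *
  generalize (a + 1)⁻¹ = v at *
  have h1 : u ^ p - v ^ p = ∑ j ∈ Finset.range p, u ^ (j + 1) * v ^ (p - j) := by
    rw [← (Commute.all u v).geom_sum₂_mul, huv, Finset.sum_mul]
    refine Finset.sum_congr rfl fun j hj => ?_
    have hj := Finset.mem_range.1 hj
    have : p - j = (p - 1 - j) + 1 := by omega
    rw [this]; ring
  have h2 : u ^ p - v ^ p = ∑ j ∈ Finset.range p, u ^ (p - j) * v ^ (j + 1) := by
    rw [h1, ← Finset.sum_range_reflect]
    refine Finset.sum_congr rfl fun j hj => ?_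
    have hj := Finset.mem_range.1 hj
    have e1 : p - 1 - j + 1 = p - j := by omega
    have e2 : p - (p - 1 - j) = j + 1 := by omega
    rw [e1, e2]
  have h3 : ∑ j ∈ Finset.range p, (u ^ (j + 1) * v ^ (p - j) + u ^ (p - j) * v ^ (j + 1)) ≤
      ∑ _j ∈ Finset.range p, (u ^ (p + 1) + v ^ (p + 1)) := by
    refine Finset.sum_le_sum fun j hj => ?_
    have hj := Finset.mem_range.1 hj
    have e : p + 1 = (j + 1) + (p - j) := by omega
    rw [e]
    exact two_term hu hv _ _
  rw [Finset.sum_add_distrib, ← h1, ← h2] at h3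
  simp at h3
  linarith

lemma tendsto_aux (p : ℕ) (hp : 2 ≤ p) {y : ℝ} (hy : 0 < y) :
    Tendsto (fun n : ℕ => (n : ℝ) * ((y + n) ^ p)⁻¹) atTop (nhds 0) := by
  have h1 : Tendsto (fun n : ℕ => ((n : ℝ))⁻¹) atTop (nhds 0) := tendsto_inv_atTop_nhds_zero_nat
  refine tendsto_of_tendsto_of_tendsto_of_le_of_le' tendsto_const_nhds h1 ?_ ?_
  · exact Eventually.of_forall fun n => by positivity
  · filter_upwards [eventually_ge_atTop 1] with n hn
    have hn' : (1 : ℝ) ≤ n := by exact_mod_cast hn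
    have h : (n : ℝ) ^ 2 ≤ (y + n) ^ p :=
      (pow_le_pow_left₀ (by positivity) (by linarith) 2).trans
        (pow_le_pow_right₀ (by linarith) hp)
    calc (n : ℝ) * ((y + n) ^ p)⁻¹ ≤ n * ((n : ℝ) ^ 2)⁻¹ := by gcongr
      _ = (n : ℝ)⁻¹ := by field_simp

lemma hurS_key {m : ℕ} (hm : 1 ≤ m) {y : ℝ} (hy : 0 < y) :
    (m + 1) * (y - 1 / 2) * hurS (m + 2) y ≤ m * hurS (m + 1) y := by
  have hs := ((hurS_summable (p := m + 1) (by omega) hy).hasSum.mul_left (m : ℝ)).sub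
    ((hurS_summable (p := m + 2) (by omega) hy).hasSum.mul_left ((m + 1) * (y - 1 / 2)))
  set U : ℕ → ℝ := fun n => (n : ℝ) * ((y + n) ^ (m + 1))⁻¹ +
    (m + 1) / 2 * (n * ((y + n) ^ (m + 2))⁻¹) with hU
  have hU0 : Tendsto U atTop (nhds 0) := by
    simpa using (tendsto_aux (m + 1) (by omega) hy).add
      ((tendsto_aux (m + 2) (by omega) hy).const_mul (((m : ℝ) + 1) / 2))
  have hstep : ∀ n : ℕ, U n - U (n + 1) ≤ m * ((y + n) ^ (m + 1))⁻¹ -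
      (m + 1) * (y - 1 / 2) * ((y + n) ^ (m + 2))⁻¹ := by
    intro n
    have ha : 0 < y + n := by positivity
    have ht := trapezoid (m + 1) ha
    have e : (y + n) * ((y + n) ^ (m + 2))⁻¹ = ((y + n) ^ (m + 1))⁻¹ := by
      rw [pow_succ' _ (m + 1)]; field_simp
    simp only [hU]
    push_cast at ht ⊢
    rw [← add_assoc y]
    have hn : (0 : ℝ) ≤ n + 1 := by positivity
    have ht' := mul_le_mul_of_nonneg_left ht hn
    have e' := congrArg (fun z => ((m : ℝ) + 1) * z) e
    rw [show m + 1 + 1 = m + 2 from rfl] at ht'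
    linear_combination ht' + e'
  have hpart : ∀ N : ℕ, -U N ≤ ∑ n ∈ Finset.range N, (m * ((y + n) ^ (m + 1))⁻¹ -
      (m + 1) * (y - 1 / 2) * ((y + n) ^ (m + 2))⁻¹) := by
    intro N
    have h := Finset.sum_le_sum (s := Finset.range N) fun n _ => hstep n
    rw [Finset.sum_range_sub'] at h
    have : U 0 = 0 := by simp [hU]
    linarith
  have := le_of_tendsto_of_tendsto' hU0.neg hs.tendsto_sum_nat hpart
  rw [neg_zero] at this
  unfold hurS
  linarith

lemma absP_key {m : ℕ} (hm : 1 ≤ m) {x β c : ℝ} (hx : 0 < x) (hβ : 1 / 2 ≤ β) (hc : (m : ℝ) ≤ c) :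
    0 ≤ c * absP m (x + β) - x * absP (m + 1) (x + β) := by
  have hy : 0 < x + β := by linarith
  have h := hurS_key hm hy
  have h1 := hurS_nonneg (m + 1) hy
  have h2 := hurS_nonneg (m + 2) hy
  have h3 : (m + 1) * x * hurS (m + 2) (x + β) ≤ c * hurS (m + 1) (x + β) := by
    calc (m + 1) * x * hurS (m + 2) (x + β)
        ≤ (m + 1) * (x + β - 1 / 2) * hurS (m + 2) (x + β) := by gcongr; linarith
      _ ≤ m * hurS (m + 1) (x + β) := h
      _ ≤ _ := by gcongr
  have h4 := mul_le_mul_of_nonneg_left h3 (Nat.cast_nonneg (α := ℝ) m.factorial)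
  rw [absP, absP, Nat.factorial_succ]
  push_cast
  linear_combination h4

theorem stmt_14 (i : ℕ) (hi : 1 ≤ i) (α β : ℝ) (hβ : 1 / 2 ≤ β) (hα : (i : ℝ) ≤ α) :
    CompletelyMonotonicOn
      (fun x : ℝ => α * |polygamma i (x + β)| - x * |polygamma (i + 1) (x + β)|) := by
  have main : ∀ k : ℕ, ∀ x : ℝ, 0 < x → iteratedDeriv k
      (fun x : ℝ => α * |polygamma i (x + β)| - x * |polygamma (i + 1) (x + β)|) x =
      (-1) ^ k * ((α + k) * absP (i + k) (x + β) - x * absP (i + k + 1) (x + β)) := by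
    intro k
    induction k with
    | zero =>
      intro x hx
      have hy : 0 < x + β := by linarith
      simp [abs_polygamma hi hy, abs_polygamma (m := i + 1) (by omega) hy]
    | succ k ih =>
      intro x hx
      have hy : 0 < x + β := by linarith
      rw [iteratedDeriv_succ]
      have h1 : iteratedDeriv k
          (fun x : ℝ => α * |polygamma i (x + β)| - x * |polygamma (i + 1) (x + β)|) =ᶠ[nhds x]
          (fun x => (-1) ^ k *
            ((α + k) * absP (i + k) (x + β) - x * absP (i + k + 1) (x + β))) := by
        filter_upwards [Ioi_mem_nhds hx] with z hz using ih z hz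
      rw [h1.deriv_eq]
      have d1 := (absP_hasDerivAt (m := i + k) (by omega) hy).comp_add_const x β
      have d2 := (absP_hasDerivAt (m := i + k + 1) (by omega) hy).comp_add_const x β
      have d3 := (((d1.const_mul (α + k)).sub ((hasDerivAt_id x).mul d2)).const_mul
        ((-1 : ℝ) ^ k)).deriv
      refine Eq.trans d3 ?_
      simp only [id, ← add_assoc]
      push_cast
      ring
  intro k x hx
  rw [main k x hx, ← mul_assoc, ← mul_pow]
  norm_num
  have := absP_key (m := i + k) (by omega) (c := α + k) hx hβ (by push_cast; linarith)
  linarith
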